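/- The number of complete matchings of {1,…,2n} with exactly k edges having no right crossing equals the number of complete matchings of {1,…,2n} with exactly k nonnested edges (edges nested by no other edge). -/

import Mathlib

open Finset Polynomial

attribute [local instance] Classical.propDecidable

/-- `M` is a complete matching of `{1,…,2n}`: each pair `(a,b)` has `a < b`
and every vertex in `{1,…,2n}` lies in exactly one pair. -/
def IsCompleteMatching (n : ℕ) (M : Finset (ℕ × ℕ)) : Prop :=
  (∀ p ∈ M, p.1 < p.2 ∧ 1 ≤ p.1 ∧ p.2 ≤ 2 * n) ∧
  (∀ v, 1 ≤ v → v ≤ 2 * n → ∃! p : ℕ × ℕ, p ∈ M ∧ (p.1 = v ∨ p.2 = v))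

/-- The finite set of all complete matchings of `{1,…,2n}`. -/
noncomputable def matchings (n : ℕ) : Finset (Finset (ℕ × ℕ)) :=
  ((Finset.Icc 1 (2 * n) ×ˢ Finset.Icc 1 (2 * n)).powerset).filter (IsCompleteMatching n)

/-- Edge `p = {a,b}` (a<b) is nested by edge `q = {a',b'}` (a'<b') if `a' < a < b < b'`. -/
def NestedBy (p q : ℕ × ℕ) : Prop := q.1 < p.1 ∧ p.2 < q.2

/-- The number of edges of `M` nested by no other edge of `M`. -/
noncomputable def nonnestedCount (M : Finset (ℕ × ℕ)) : ℕ :=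
  (M.filter (fun p => ∀ q ∈ M, ¬ NestedBy p q)).card

/-- Edge `p = {a,b}` (a<b) has a right crossing from `q = {a',b'}` (a'<b') if `a < a' < b < b'`. -/
def RightCrossing (p q : ℕ × ℕ) : Prop := p.1 < q.1 ∧ q.1 < p.2 ∧ p.2 < q.2

/-- The number of edges of `M` having no right crossing. -/
noncomputable def noRightCrossingCount (M : Finset (ℕ × ℕ)) : ℕ :=
  (M.filter (fun p => ∀ q ∈ M, ¬ RightCrossing p q)).card

/-- `M` completes a set `S` of open left endpoints by matching `S ∪ [v, v + m)`, every right
endpoint lying in `[v, v + m)`. -/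
def IsCompletion (S : Finset ℕ) (v m : ℕ) (M : Finset (ℕ × ℕ)) : Prop :=
  (∀ p ∈ M, p.1 < p.2 ∧ (p.1 ∈ S ∨ v ≤ p.1) ∧ v ≤ p.2 ∧ p.2 < v + m) ∧
  (∀ u, (u ∈ S ∨ (v ≤ u ∧ u < v + m)) → ∃! p : ℕ × ℕ, p ∈ M ∧ (p.1 = u ∨ p.2 = u))

/-- The completions of `S` by `[v, v + m)`, listed according to whether `v` is a left endpoint or
which element of `S` it is matched to. -/
noncomputable def completions : Finset ℕ → ℕ → ℕ → Finset (Finset (ℕ × ℕ))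
  | S, _, 0 => if S = ∅ then {∅} else ∅
  | S, v, m + 1 => completions (insert v S) (v + 1) m ∪
      S.biUnion fun a => (completions (S.erase a) (v + 1) m).image (insert (a, v))

/-- The number of edges `p` of `M` such that no edge `q` open at `p.2` satisfies `r p.1 q.1`. -/
noncomputable def extremalCount (r : ℕ → ℕ → Prop) (M : Finset (ℕ × ℕ)) : ℕ :=
  (M.filter fun p => ∀ q ∈ M, ¬ (p.2 < q.2 ∧ q.1 < p.2 ∧ r p.1 q.1)).card

/-- The generating polynomial of `extremalCount` over the completions of an `s`-element set by
`m` further vertices. -/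
noncomputable def completionPoly : ℕ → ℕ → ℕ[X]
  | 0, 0 => 1
  | 0, _ + 1 => 0
  | m + 1, 0 => completionPoly m 1
  | m + 1, s + 1 => completionPoly m (s + 2) + (X + (s : ℕ[X])) * completionPoly m s

theorem isCompletion_zero {S : Finset ℕ} {v : ℕ} {M : Finset (ℕ × ℕ)} :
    IsCompletion S v 0 M ↔ S = ∅ ∧ M = ∅ := by
  constructor
  · rintro ⟨h1, h2⟩
    have hM : M = ∅ := by
      rw [Finset.eq_empty_iff_forall_notMem]
      intro p hp
      have := h1 p hp
      omega
    refine ⟨?_, hM⟩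
    rw [Finset.eq_empty_iff_forall_notMem]
    intro a ha
    obtain ⟨p, ⟨hp, -⟩, -⟩ := h2 a (Or.inl ha)
    simp [hM] at hp
  · rintro ⟨rfl, rfl⟩
    refine ⟨by simp, ?_⟩
    rintro u (hu | hu)
    · simp at hu
    · omega

theorem IsCompletion.eq_of_mem {S : Finset ℕ} {v m : ℕ} {M : Finset (ℕ × ℕ)}
    (h : IsCompletion S v m M) {u : ℕ} (hu : u ∈ S ∨ (v ≤ u ∧ u < v + m)) {p q : ℕ × ℕ}
    (hp : p ∈ M) (hpu : p.1 = u ∨ p.2 = u) (hq : q ∈ M) (hqu : q.1 = u ∨ q.2 = u) : p = q :=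
  (h.2 u hu).unique ⟨hp, hpu⟩ ⟨hq, hqu⟩

theorem IsCompletion.of_insert_left {S : Finset ℕ} {v m : ℕ} {M : Finset (ℕ × ℕ)}
    (h : IsCompletion (insert v S) (v + 1) m M) : IsCompletion S v (m + 1) M := by
  refine ⟨fun p hp => ?_, fun u hu => h.2 u ?_⟩
  · have := h.1 p hp
    grind
  · grind

theorem IsCompletion.insert_edge {S : Finset ℕ} {v m a : ℕ} {M : Finset (ℕ × ℕ)}
    (hS : ∀ c ∈ S, c < v) (ha : a ∈ S) (h : IsCompletion (S.erase a) (v + 1) m M) :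
    IsCompletion S v (m + 1) (insert (a, v) M) := by
  have hav := hS a ha
  refine ⟨fun p hp => ?_, fun u hu => ?_⟩
  · rcases Finset.mem_insert.1 hp with rfl | hp
    · exact ⟨hav, Or.inl ha, le_rfl, by omega⟩
    · have := h.1 p hp
      grind
  · by_cases hua : u = a ∨ u = v
    · refine ⟨(a, v), ⟨Finset.mem_insert_self _ _, by grind⟩, ?_⟩
      rintro p ⟨hp, hpu⟩
      rcases Finset.mem_insert.1 hp with rfl | hp
      · rfl
      · have := h.1 p hp
        grind
    · obtain ⟨p, ⟨hp, hpu⟩, huniq⟩ := h.2 u (by grind)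
      refine ⟨p, ⟨Finset.mem_insert_of_mem hp, hpu⟩, ?_⟩
      rintro q ⟨hq, hqu⟩
      rcases Finset.mem_insert.1 hq with rfl | hq
      · grind
      · exact huniq q ⟨hq, hqu⟩

theorem IsCompletion.erase_edge {S : Finset ℕ} {v m a : ℕ} {M : Finset (ℕ × ℕ)}
    (hS : ∀ c ∈ S, c < v) (ha : a ∈ S) (h : IsCompletion S v (m + 1) M) (hM : (a, v) ∈ M) :
    IsCompletion (S.erase a) (v + 1) m (M.erase (a, v)) := by
  have hav := hS a ha
  refine ⟨fun p hp => ?_, fun u hu => ?_⟩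
  · obtain ⟨hne, hp⟩ := Finset.mem_erase.1 hp
    have h1 := h.1 p hp
    have hv : p.1 ≠ v ∧ p.2 ≠ v := by
      constructor <;> intro hpv <;>
        exact hne (h.eq_of_mem (u := v) (by omega) hp (by simp [hpv]) hM (by simp))
    have hpa : p.1 ≠ a := fun hpa =>
      hne (h.eq_of_mem (Or.inl ha) hp (Or.inl hpa) hM (by simp))
    grind
  · obtain ⟨p, ⟨hp, hpu⟩, huniq⟩ := h.2 u (by grind)
    refine ⟨p, ⟨Finset.mem_erase.2 ⟨by grind, hp⟩, hpu⟩, ?_⟩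
    rintro q ⟨hq, hqu⟩
    exact huniq q ⟨Finset.mem_of_mem_erase hq, hqu⟩

theorem isCompletion_succ {S : Finset ℕ} {v m : ℕ} {M : Finset (ℕ × ℕ)}
    (hS : ∀ c ∈ S, c < v) :
    IsCompletion S v (m + 1) M ↔ IsCompletion (insert v S) (v + 1) m M ∨
      ∃ a ∈ S, ∃ M', IsCompletion (S.erase a) (v + 1) m M' ∧ insert (a, v) M' = M := by
  constructor
  · intro h
    obtain ⟨p, ⟨hp, hpv⟩, -⟩ := h.2 v (by omega)
    have hp1 := h.1 p hp
    rcases hpv with hpv | hpv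
    · left
      refine ⟨fun q hq => ?_, fun u hu => h.2 u (by grind)⟩
      have hq1 := h.1 q hq
      have : q.2 ≠ v := by
        intro hqv
        have := h.eq_of_mem (u := v) (by omega) hp (Or.inl hpv) hq (Or.inr hqv)
        subst this
        omega
      grind
    · right
      obtain ⟨a, b⟩ := p
      obtain rfl : b = v := hpv
      have ha : a ∈ S := by grind
      exact ⟨a, ha, M.erase (a, b), h.erase_edge hS ha hp, Finset.insert_erase hp⟩
  · rintro (h | ⟨a, ha, M', h, rfl⟩)
    · exact h.of_insert_left
    · exact h.insert_edge hS ha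

theorem mem_completions {S : Finset ℕ} {v m : ℕ} {M : Finset (ℕ × ℕ)} (hS : ∀ c ∈ S, c < v) :
    M ∈ completions S v m ↔ IsCompletion S v m M := by
  induction m generalizing S v M with
  | zero =>
    rw [isCompletion_zero, completions]
    split_ifs with h <;> simp [h]
  | succ m ih =>
    have hinsert : ∀ c ∈ insert v S, c < v + 1 := by grind
    have herase (a : ℕ) : ∀ c ∈ S.erase a, c < v + 1 := by grind
    simp only [isCompletion_succ hS, completions, Finset.mem_union, Finset.mem_biUnion,
      Finset.mem_image, ih hinsert, ih (herase _)]

theorem IsCompletion.notMem_of_snd_lt {S : Finset ℕ} {v m : ℕ} {M : Finset (ℕ × ℕ)}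
    (h : IsCompletion S v m M) {p : ℕ × ℕ} (hp : p.2 < v) : p ∉ M := fun hM => by
  have := h.1 p hM
  omega

theorem extremalCount_insert {r : ℕ → ℕ → Prop} (hirr : ∀ a, ¬ r a a) {S : Finset ℕ}
    {v m a : ℕ} {M : Finset (ℕ × ℕ)} (hS : ∀ c ∈ S, c < v)
    (h : IsCompletion (S.erase a) (v + 1) m M) :
    extremalCount r (insert (a, v) M) =
      extremalCount r M + if ∀ c ∈ S, ¬ r a c then 1 else 0 := by
  have hnot : (a, v) ∉ M := h.notMem_of_snd_lt (Nat.lt_succ_self v)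
  have hrest : (M.filter fun p => ∀ q ∈ insert (a, v) M,
      ¬ (p.2 < q.2 ∧ q.1 < p.2 ∧ r p.1 q.1)) =
      M.filter fun p => ∀ q ∈ M, ¬ (p.2 < q.2 ∧ q.1 < p.2 ∧ r p.1 q.1) := by
    refine Finset.filter_congr fun p hp => ?_
    have := h.1 p hp
    rw [Finset.forall_mem_insert, and_iff_right]
    rintro ⟨h1, -⟩
    simp only at h1
    omega
  have hnew : (∀ q ∈ insert (a, v) M, ¬ (v < q.2 ∧ q.1 < v ∧ r a q.1)) ↔
      ∀ c ∈ S, ¬ r a c := by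
    constructor
    · intro hq c hc hac
      have hca : c ≠ a := by
        rintro rfl
        exact hirr _ hac
      obtain ⟨p, ⟨hp, hpc⟩, -⟩ := h.2 c (Or.inl (Finset.mem_erase.2 ⟨hca, hc⟩))
      have hp1 := h.1 p hp
      have hcv := hS c hc
      have hpc : p.1 = c := by omega
      exact hq p (Finset.mem_insert_of_mem hp) ⟨by omega, by omega, hpc ▸ hac⟩
    · rintro hc q hq ⟨h1, h2, h3⟩
      rcases Finset.mem_insert.1 hq with rfl | hq
      · exact hirr _ h3
      · have := h.1 q hq
        exact hc q.1 (by grind) h3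
  unfold extremalCount
  rw [Finset.filter_insert, hrest]
  simp only [hnew]
  split_ifs with hc
  · rw [Finset.card_insert_of_notMem (by simp [hnot])]
  · rfl

theorem sum_completions_succ {R : Type*} [AddCommMonoid R] (f : Finset (ℕ × ℕ) → R)
    {S : Finset ℕ} {v m : ℕ} (hS : ∀ c ∈ S, c < v) :
    ∑ M ∈ completions S v (m + 1), f M =
      ∑ M ∈ completions (insert v S) (v + 1) m, f M +
        ∑ a ∈ S, ∑ M ∈ completions (S.erase a) (v + 1) m, f (insert (a, v) M) := by
  have hinsert : ∀ c ∈ insert v S, c < v + 1 := by grind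
  have herase (a : ℕ) : ∀ c ∈ S.erase a, c < v + 1 := by grind
  have hnot {a b : ℕ} {M : Finset (ℕ × ℕ)} (hM : M ∈ completions (S.erase a) (v + 1) m) :
      (b, v) ∉ M :=
    ((mem_completions (herase a)).1 hM).notMem_of_snd_lt (Nat.lt_succ_self v)
  rw [completions, Finset.sum_union, Finset.sum_biUnion]
  · congr 1
    refine Finset.sum_congr rfl fun a _ => Finset.sum_image fun M hM M' hM' hMM => ?_
    rw [← Finset.erase_insert (hnot hM), hMM, Finset.erase_insert (hnot hM')]
  · intro a _ b _ hab
    refine Finset.disjoint_left.2 fun M hMa hMb => hab ?_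
    obtain ⟨M₁, -, rfl⟩ := Finset.mem_image.1 hMa
    obtain ⟨M₂, hM₂, hMM⟩ := Finset.mem_image.1 hMb
    have hmem : (a, v) ∈ insert (b, v) M₂ := hMM ▸ Finset.mem_insert_self _ _
    rcases Finset.mem_insert.1 hmem with heq | hmem
    · exact congrArg Prod.fst heq
    · exact absurd hmem (hnot hM₂)
  · refine Finset.disjoint_left.2 fun M hM hM' => ?_
    obtain ⟨a, -, hM'⟩ := Finset.mem_biUnion.1 hM'
    obtain ⟨M', -, rfl⟩ := Finset.mem_image.1 hM'
    exact ((mem_completions hinsert).1 hM).notMem_of_snd_lt (p := (a, v)) (Nat.lt_succ_self v)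
      (Finset.mem_insert_self _ _)

theorem sum_X_pow_extremalCount {r : ℕ → ℕ → Prop} (hirr : ∀ a, ¬ r a a)
    (hr : ∀ S : Finset ℕ, S.Nonempty → ∃ a ∈ S, ∀ b ∈ S, (∀ c ∈ S, ¬ r b c) ↔ b = a)
    {S : Finset ℕ} {v m : ℕ} (hS : ∀ c ∈ S, c < v) :
    ∑ M ∈ completions S v m, (X : ℕ[X]) ^ extremalCount r M = completionPoly m S.card := by
  induction m generalizing S v with
  | zero =>
    rcases S.eq_empty_or_nonempty with rfl | hne
    · simp [completions, completionPoly, extremalCount]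
    · obtain ⟨s, hs⟩ := Nat.exists_eq_succ_of_ne_zero hne.card_pos.ne'
      simp [completions, completionPoly, hs, hne.ne_empty]
  | succ m ih =>
    have hinsert : ∀ c ∈ insert v S, c < v + 1 := by grind
    have herase (a : ℕ) : ∀ c ∈ S.erase a, c < v + 1 := by grind
    have hv : v ∉ S := fun h => (hS v h).false
    have hstep : ∀ a ∈ S, ∑ M ∈ completions (S.erase a) (v + 1) m,
        (X : ℕ[X]) ^ extremalCount r (insert (a, v) M) =
        (if ∀ c ∈ S, ¬ r a c then X else 1) * completionPoly m (S.card - 1) := by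
      intro a ha
      rw [← Finset.card_erase_of_mem ha, ← ih (herase a), Finset.mul_sum]
      refine Finset.sum_congr rfl fun M hM => ?_
      rw [extremalCount_insert hirr hS ((mem_completions (herase a)).1 hM), pow_add, mul_comm]
      split_ifs <;> simp
    rw [sum_completions_succ _ hS, ih hinsert, Finset.card_insert_of_notMem hv,
      Finset.sum_congr rfl hstep, ← Finset.sum_mul]
    rcases S.eq_empty_or_nonempty with rfl | hne
    · simp [completionPoly]
    · obtain ⟨a, ha, hiff⟩ := hr S hne
      obtain ⟨s, hs⟩ := Nat.exists_eq_succ_of_ne_zero hne.card_pos.ne'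
      have hsum : ∑ b ∈ S, (if ∀ c ∈ S, ¬ r b c then (X : ℕ[X]) else 1) = X + (s : ℕ[X]) := by
        rw [← Finset.add_sum_erase S _ ha, if_pos ((hiff a ha).2 rfl)]
        congr 1
        rw [Finset.sum_congr rfl (g := fun _ => (1 : ℕ[X])), Finset.sum_const,
          Finset.card_erase_of_mem ha, hs]
        · simp
        · intro b hb
          obtain ⟨hba, hb⟩ := Finset.mem_erase.1 hb
          rw [if_neg fun h => hba ((hiff b hb).1 h)]
      rw [hsum, hs, completionPoly]
      rfl

theorem matchings_eq_completions (n : ℕ) : matchings n = completions ∅ 1 (2 * n) := by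
  ext M
  rw [mem_completions (by simp), matchings, Finset.mem_filter, Finset.mem_powerset]
  constructor
  · rintro ⟨-, h1, h2⟩
    refine ⟨fun p hp => ?_, fun u hu => ?_⟩
    · have := h1 p hp
      exact ⟨this.1, Or.inr this.2.1, by omega, by omega⟩
    · simp only [Finset.notMem_empty, false_or] at hu
      exact h2 u hu.1 (by omega)
  · rintro ⟨h1, h2⟩
    have h1' : ∀ p ∈ M, p.1 < p.2 ∧ 1 ≤ p.1 ∧ p.2 ≤ 2 * n := by
      intro p hp
      have := h1 p hp
      simp only [Finset.notMem_empty, false_or] at this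
      omega
    refine ⟨fun p hp => ?_, h1', fun u hu hu' => h2 u (Or.inr (by omega))⟩
    have := h1' p hp
    simp only [Finset.mem_product, Finset.mem_Icc]
    omega

theorem card_filter_extremalCount {r : ℕ → ℕ → Prop} (hirr : ∀ a, ¬ r a a)
    (hr : ∀ S : Finset ℕ, S.Nonempty → ∃ a ∈ S, ∀ b ∈ S, (∀ c ∈ S, ¬ r b c) ↔ b = a)
    (n k : ℕ) :
    ((matchings n).filter fun M => extremalCount r M = k).card =
      (completionPoly (2 * n) 0).coeff k := by
  rw [matchings_eq_completions, ← Finset.card_empty (α := ℕ),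
    ← sum_X_pow_extremalCount hirr hr (S := ∅) (v := 1) (by simp), Polynomial.finsetSum_coeff,
    Finset.card_filter]
  simp only [Polynomial.coeff_X_pow, eq_comm]

theorem extremalCount_eq_card_filter {r : ℕ → ℕ → Prop} {M : Finset (ℕ × ℕ)}
    {P : ℕ × ℕ → Prop} [DecidablePred P]
    (h : ∀ p ∈ M, (∀ q ∈ M, ¬ (p.2 < q.2 ∧ q.1 < p.2 ∧ r p.1 q.1)) ↔ P p) :
    extremalCount r M = (M.filter P).card :=
  congrArg Finset.card (Finset.filter_congr h)

theorem noRightCrossingCount_eq_extremalCount (M : Finset (ℕ × ℕ)) :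
    noRightCrossingCount M = extremalCount (· < ·) M := by
  refine (extremalCount_eq_card_filter fun p _ => forall₂_congr fun q _ => not_congr ?_).symm
  unfold RightCrossing
  tauto

theorem nonnestedCount_eq_extremalCount {n : ℕ} {M : Finset (ℕ × ℕ)} (hM : M ∈ matchings n) :
    nonnestedCount M = extremalCount (· > ·) M := by
  refine (extremalCount_eq_card_filter fun p hp => forall₂_congr fun q _ => not_congr ?_).symm
  have := (Finset.mem_filter.1 hM).2.1 p hp
  unfold NestedBy
  omega

/-- Equidistribution: as many complete matchings of `{1,…,2n}` have exactly `k`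
edges with no right crossing as have exactly `k` nonnested edges. -/
theorem noRightCrossing_equidistributed_nonnested (n k : ℕ) :
    ((matchings n).filter (fun M => noRightCrossingCount M = k)).card =
      ((matchings n).filter (fun M => nonnestedCount M = k)).card := by
  have hlt := card_filter_extremalCount (r := (· < ·)) (fun a => lt_irrefl a)
    (fun S hS => ⟨S.max' hS, S.max'_mem hS, fun b hb =>
      ⟨fun h => le_antisymm (S.le_max' b hb) (not_lt.1 (h _ (S.max'_mem hS))),
        fun h c hc => h ▸ not_lt.2 (S.le_max' c hc)⟩⟩) n k
  have hgt := card_filter_extremalCount (r := (· > ·)) (fun a => lt_irrefl a)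
    (fun S hS => ⟨S.min' hS, S.min'_mem hS, fun b hb =>
      ⟨fun h => le_antisymm (not_lt.1 (h _ (S.min'_mem hS))) (S.min'_le b hb),
        fun h c hc => h ▸ not_lt.2 (S.min'_le c hc)⟩⟩) n k
  simp only [noRightCrossingCount_eq_extremalCount]
  rw [hlt, ← hgt]
  refine congrArg Finset.card (Finset.filter_congr fun M hM => ?_)
  rw [nonnestedCount_eq_extremalCount hM]
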